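/- ∫₀¹ x·log²(x)/(x²-x+1) dx = 5π³/(81√3) - (2/3)ζ(3). -/

import Mathlib

theorem aux_hs {f g : ℕ → ℝ} {a b : ℝ} (h : HasSum f a) (hf : ∀ n, g n = f n) (hb : b = a) :
    HasSum g b := by
  rw [hb, funext hf]
  exact h

theorem aux_hd {f g : ℝ → ℝ} {a b x : ℝ} (h : HasDerivAt f a x) (hf : ∀ y, g y = f y)
    (hb : b = a) : HasDerivAt g b x := by
  rw [hb, funext hf]
  exact h

theorem aux_cont : ContinuousOn (fun x : ℝ => x * Real.log x ^ 2) (Set.Icc 0 1) := by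
  have h : Continuous (fun x : ℝ => 4 * (Real.sqrt x * Real.log (Real.sqrt x)) ^ 2) := by
    have := Real.continuous_mul_log.comp Real.continuous_sqrt
    exact continuous_const.mul (this.pow 2)
  refine h.continuousOn.congr ?_
  intro x hx
  have := Real.sq_sqrt hx.1
  simp only [Real.log_sqrt hx.1, mul_pow, div_pow, this]
  ring

theorem aux_int (n : ℕ) :
    IntervalIntegrable (fun x : ℝ => x ^ n * Real.log x ^ 2) MeasureTheory.volume 0 1 ∧
    ∫ x in (0:ℝ)..1, x ^ n * Real.log x ^ 2 = 2 / ((n : ℝ) + 1) ^ 3 := by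
  have hn : (n : ℝ) + 1 ≠ 0 := by positivity
  let F : ℝ → ℝ := fun x => x ^ n * ((x * Real.log x ^ 2) / (n + 1)
    - 2 * (x * Real.log x) / (n + 1) ^ 2 + 2 * x / (n + 1) ^ 3)
  have hF : ContinuousOn F (Set.Icc 0 1) := by
    have h1 := aux_cont
    have h2 : ContinuousOn (fun x : ℝ => x * Real.log x) (Set.Icc 0 1) :=
      Real.continuous_mul_log.continuousOn
    refine ContinuousOn.mul (by fun_prop) ?_
    exact ((h1.div_const _).sub ((continuousOn_const.mul h2).div_const _)).add (by fun_prop)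
  have hd : ∀ x ∈ Set.Ioo (0:ℝ) 1, HasDerivAt F (x ^ n * Real.log x ^ 2) x := by
    intro x hx
    have hx0 : x ≠ 0 := hx.1.ne'
    have hl := Real.hasDerivAt_log hx0
    have hi := hasDerivAt_id x
    have := (hasDerivAt_pow (n + 1) x).mul ((((hl.pow 2).div_const ((n:ℝ) + 1)).sub
      ((hl.const_mul 2).div_const (((n:ℝ) + 1) ^ 2))).add_const (2 / ((n:ℝ) + 1) ^ 3))
    refine aux_hd this ?_ ?_
    · intro y
      simp [F]
      ring
    · simp
      field_simp
      ring
  have hI : IntervalIntegrable (fun x : ℝ => x ^ n * Real.log x ^ 2) MeasureTheory.volume 0 1 := by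
    rw [intervalIntegrable_iff_integrableOn_Ioc_of_le zero_le_one]
    refine intervalIntegral.integrableOn_deriv_of_nonneg hF hd ?_
    intro x hx
    have := hx.1
    positivity
  refine ⟨hI, ?_⟩
  rw [intervalIntegral.integral_eq_sub_of_hasDerivAt_of_le zero_le_one hF hd hI]
  simp [F]

theorem aux_rec (n : ℕ) : Real.sin ((n + 2 : ℕ) * (Real.pi / 3)) =
    Real.sin ((n + 1 : ℕ) * (Real.pi / 3)) - Real.sin (n * (Real.pi / 3)) := by
  have h1 : ((n + 2 : ℕ) : ℝ) * (Real.pi / 3) = (n + 1 : ℕ) * (Real.pi / 3) + Real.pi / 3 := by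
    push_cast; ring
  have h2 : (n : ℝ) * (Real.pi / 3) = (n + 1 : ℕ) * (Real.pi / 3) - Real.pi / 3 := by
    push_cast; ring
  rw [h1, h2, Real.sin_add, Real.sin_sub, Real.cos_pi_div_three]
  ring

theorem aux_gen (x : ℝ) (hx : x ∈ Set.Ioo (0:ℝ) 1) :
    HasSum (fun n : ℕ => Real.sin (n * (Real.pi / 3)) * x ^ n)
      (Real.sqrt 3 / 2 * (x / (x ^ 2 - x + 1))) := by
  have hs : Summable (fun n : ℕ => Real.sin (n * (Real.pi / 3)) * x ^ n) := by
    refine Summable.of_norm_bounded (summable_geometric_of_lt_one hx.1.le hx.2) ?_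
    intro n
    rw [norm_mul, Real.norm_eq_abs, Real.norm_eq_abs, abs_of_nonneg (pow_nonneg hx.1.le n)]
    exact mul_le_of_le_one_left (pow_nonneg hx.1.le n) (Real.abs_sin_le_one _)
  have e1 := hs.sum_add_tsum_nat_add 1
  have e2 := hs.sum_add_tsum_nat_add 2
  have e3 : ∑' n : ℕ, Real.sin ((n + 2 : ℕ) * (Real.pi / 3)) * x ^ (n + 2) =
      x * ∑' n : ℕ, Real.sin ((n + 1 : ℕ) * (Real.pi / 3)) * x ^ (n + 1) -
      x ^ 2 * ∑' n : ℕ, Real.sin (n * (Real.pi / 3)) * x ^ n := by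
    rw [← tsum_mul_left, ← tsum_mul_left, ← Summable.tsum_sub]
    · congr 1
      funext n
      rw [aux_rec]
      ring
    · exact ((summable_nat_add_iff 1).2 hs).mul_left x
    · exact hs.mul_left _
  rw [e3] at e2
  simp [Finset.sum_range_succ, -Nat.cast_add] at e1
  simp [Finset.sum_range_succ, -Nat.cast_add] at e2
  push_cast at e1 e2
  rw [e1] at e2
  convert hs.hasSum using 1
  have : x ^ 2 - x + 1 ≠ 0 := by nlinarith [sq_nonneg (x - 1)]
  rw [← mul_div_assoc, div_eq_iff this]
  linarith

theorem aux_zeta : Summable (fun k : ℕ => 1 / ((k : ℝ) + 1) ^ 3) := by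
  have := (summable_nat_add_iff 1).2 (Real.summable_one_div_nat_pow.2 (by norm_num : 1 < 3))
  simpa using this

theorem aux_swap :
    HasSum (fun n : ℕ => Real.sin (n * (Real.pi / 3)) * (2 / ((n : ℝ) + 1) ^ 3))
      (Real.sqrt 3 / 2 * ∫ x in (0:ℝ)..1, x * Real.log x ^ 2 / (x ^ 2 - x + 1)) := by
  let f : ℕ → ℝ → ℝ := fun n x => Real.sin (n * (Real.pi / 3)) * (x ^ n * Real.log x ^ 2)
  have hint : ∀ n, MeasureTheory.IntegrableOn (f n) (Set.Ioo 0 1) := by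
    intro n
    have := (aux_int n).1
    rw [intervalIntegrable_iff_integrableOn_Ioo_of_le zero_le_one] at this
    exact this.const_mul _
  have hval : ∀ n : ℕ, ∫ x in Set.Ioo (0:ℝ) 1, x ^ n * Real.log x ^ 2 = 2 / ((n : ℝ) + 1) ^ 3 := by
    intro n
    rw [← (aux_int n).2, intervalIntegral.integral_of_le zero_le_one,
      MeasureTheory.integral_Ioc_eq_integral_Ioo]
  have hsum : Summable (fun n => ∫ x in Set.Ioo (0:ℝ) 1, ‖f n x‖) := by
    refine Summable.of_nonneg_of_le (fun n => by positivity) (fun n => ?_) (aux_zeta.mul_left 2)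
    have : ∫ x in Set.Ioo (0:ℝ) 1, ‖f n x‖ = |Real.sin (n * (Real.pi / 3))| *
        ∫ x in Set.Ioo (0:ℝ) 1, x ^ n * Real.log x ^ 2 := by
      rw [← MeasureTheory.integral_const_mul]
      refine MeasureTheory.setIntegral_congr_fun measurableSet_Ioo ?_
      intro x hx
      have : 0 ≤ x ^ n * Real.log x ^ 2 := mul_nonneg (pow_nonneg hx.1.le n) (sq_nonneg _)
      simp only [f, Real.norm_eq_abs]
      rw [abs_mul, abs_of_nonneg this]
    rw [this, hval, mul_one_div]
    exact mul_le_of_le_one_left (by positivity) (Real.abs_sin_le_one _)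
  have key := MeasureTheory.hasSum_integral_of_summable_integral_norm hint hsum
  refine aux_hs key ?_ ?_
  · intro n
    simp only [f]
    rw [MeasureTheory.integral_const_mul, hval]
  · rw [intervalIntegral.integral_of_le zero_le_one,
      MeasureTheory.integral_Ioc_eq_integral_Ioo, ← MeasureTheory.integral_const_mul]
    refine MeasureTheory.setIntegral_congr_fun measurableSet_Ioo ?_
    intro x hx
    have := ((aux_gen x hx).mul_right (Real.log x ^ 2)).tsum_eq
    simp only [f, ← mul_assoc]
    rw [this]
    ring

theorem aux_sin : HasSum (fun n : ℕ => 1 / (n : ℝ) ^ 3 * Real.sin (n * (Real.pi / 3)))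
    (5 * Real.pi ^ 3 / 162) := by
  have h := hasSum_one_div_nat_pow_mul_sin (k := 1) one_ne_zero (x := 1 / 6) (by norm_num)
  refine aux_hs h ?_ ?_
  · intro n
    congr 2
    ring
  · have : (Polynomial.map (algebraMap ℚ ℝ) (Polynomial.bernoulli 3)).eval (1 / 6 : ℝ) = 5 / 108 := by
      have h0 : bernoulli 0 = 1 := bernoulli_zero
      have h1 : bernoulli 1 = -1 / 2 := bernoulli_one
      have h2 : bernoulli 2 = 1 / 6 := by
        rw [bernoulli_eq_bernoulli'_of_ne_one (by norm_num), bernoulli'_two]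
      have h3 : bernoulli 3 = 0 := by
        rw [bernoulli_eq_bernoulli'_of_ne_one (by norm_num), bernoulli'_three]
      have hc : Nat.choose 3 2 = 3 := by decide
      simp [Polynomial.bernoulli, Finset.sum_range_succ, h0, h1, h2, h3, hc]
      norm_num
    simp only [show 2 * 1 + 1 = 3 from rfl]
    rw [this]
    norm_num [Nat.factorial]
    ring

theorem aux_cosval (n : ℕ) : Real.cos (n * (Real.pi / 3)) = 1 / 2 - (if 2 ∣ n then 1 else 0)
    - 3 / 2 * (if 3 ∣ n then 1 else 0) + 3 * (if 6 ∣ n then 1 else 0) := by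
  have hstep : ∀ m : ℕ, Real.cos ((m + 3 : ℕ) * (Real.pi / 3)) = - Real.cos (m * (Real.pi / 3)) := by
    intro m
    rw [← Real.cos_add_pi]
    congr 1
    push_cast
    ring
  induction n using Nat.strong_induction_on with
  | _ n ih =>
    by_cases h : 6 ≤ n
    · obtain ⟨m, rfl⟩ := Nat.exists_eq_add_of_le' h
      rw [show m + 6 = (m + 3) + 3 from rfl, hstep, hstep, neg_neg, ih m (by omega)]
      have a2 : 2 ∣ m + 3 + 3 ↔ 2 ∣ m := by omega
      have a3 : 3 ∣ m + 3 + 3 ↔ 3 ∣ m := by omega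
      have a6 : 6 ∣ m + 3 + 3 ↔ 6 ∣ m := by omega
      simp only [a2, a3, a6]
    · have c2 : Real.cos ((2 : ℕ) * (Real.pi / 3)) = -1 / 2 := by
        rw [Nat.cast_ofNat, Real.cos_two_mul, Real.cos_pi_div_three]; norm_num
      have c1 : Real.cos ((1 : ℕ) * (Real.pi / 3)) = 1 / 2 := by
        rw [Nat.cast_one, one_mul, Real.cos_pi_div_three]
      have c0 : Real.cos ((0 : ℕ) * (Real.pi / 3)) = 1 := by simp
      have c3 := hstep 0
      have c4 := hstep 1
      have c5 := hstep 2
      rw [c0] at c3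
      rw [c1] at c4
      rw [c2] at c5
      simp only [Nat.reduceAdd] at c3 c4 c5
      have : n < 6 := by omega
      interval_cases n
      · rw [c0]; norm_num
      · rw [c1]; norm_num
      · rw [c2]; norm_num
      · rw [c3]; norm_num
      · rw [c4]; norm_num
      · rw [c5]; norm_num

theorem aux_dvd (z : ℝ) (hz : HasSum (fun n : ℕ => 1 / (n : ℝ) ^ 3) z) (d : ℕ) (hd : 0 < d) :
    HasSum (fun n : ℕ => 1 / (n : ℝ) ^ 3 * (if d ∣ n then 1 else 0)) (z / d ^ 3) := by
  have hinj : Function.Injective (fun n : ℕ => d * n) := fun a b h => Nat.eq_of_mul_eq_mul_left hd h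
  rw [← hinj.hasSum_iff]
  · refine aux_hs (hz.div_const ((d : ℝ) ^ 3)) ?_ rfl
    intro n
    simp
    ring
  · intro n hn
    have : ¬ d ∣ n := fun ⟨k, hk⟩ => hn ⟨k, hk.symm⟩
    simp [this]

theorem aux_cos (z : ℝ) (hz : HasSum (fun n : ℕ => 1 / (n : ℝ) ^ 3) z) :
    HasSum (fun n : ℕ => 1 / (n : ℝ) ^ 3 * Real.cos (n * (Real.pi / 3))) (z / 3) := by
  have h := (((hz.mul_left (1 / 2)).sub (aux_dvd z hz 2 (by norm_num))).sub
    ((aux_dvd z hz 3 (by norm_num)).mul_left (3 / 2))).add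
    ((aux_dvd z hz 6 (by norm_num)).mul_left 3)
  refine aux_hs h ?_ ?_
  · intro n
    rw [aux_cosval]
    ring
  · push_cast
    ring

theorem stmt14 :
    ∫ x in (0:ℝ)..1, x * Real.log x ^ 2 / (x ^ 2 - x + 1) =
      5 * Real.pi ^ 3 / (81 * Real.sqrt 3) - (2 / 3) * ∑' k : ℕ, 1 / ((k : ℝ) + 1) ^ 3 := by
  set I := ∫ x in (0:ℝ)..1, x * Real.log x ^ 2 / (x ^ 2 - x + 1) with hI
  set z := ∑' k : ℕ, 1 / ((k : ℝ) + 1) ^ 3 with hzdef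
  have hz : HasSum (fun n : ℕ => 1 / (n : ℝ) ^ 3) z := by
    rw [← hasSum_nat_add_iff' 1]
    refine aux_hs aux_zeta.hasSum (fun n => by simp) (by simp [hzdef])
  have h1 := (aux_sin.mul_left (1 / 2)).sub ((aux_cos z hz).mul_left (Real.sqrt 3 / 2))
  rw [← hasSum_nat_add_iff' 1] at h1
  have h2 := aux_swap.mul_left (1 / 2)
  rw [← hI] at h2
  have h3 : (fun n : ℕ => 1 / 2 * (Real.sin (n * (Real.pi / 3)) * (2 / ((n : ℝ) + 1) ^ 3))) =
      fun n : ℕ => 1 / 2 * (1 / ((n + 1 : ℕ) : ℝ) ^ 3 * Real.sin ((n + 1 : ℕ) * (Real.pi / 3))) -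
        Real.sqrt 3 / 2 * (1 / ((n + 1 : ℕ) : ℝ) ^ 3 * Real.cos ((n + 1 : ℕ) * (Real.pi / 3))) := by
    funext n
    have e : (n : ℝ) * (Real.pi / 3) = (n + 1 : ℕ) * (Real.pi / 3) - Real.pi / 3 := by
      push_cast; ring
    rw [e, Real.sin_sub, Real.cos_pi_div_three, Real.sin_pi_div_three]
    push_cast
    ring
  rw [h3] at h2
  have h4 := h2.unique h1
  simp at h4
  have hs : Real.sqrt 3 ≠ 0 := by positivity
  field_simp
  field_simp at h4
  linarith
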